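/- Let n ≥ 3 be an integer and, for i ≥ 0, let H(i) be the number of tuples (α_1,…,α_n) of non-negative integers with α_1 + … + α_n = 2i and α_j ≤ i for all j. Then in the ring of formal power series over ℤ: (1 − t)^n · Σ_{i≥0} H(i) t^i = ( Σ_{l≥0} C(n, 2l) t^l ) − n·t. -/

import Mathlib

open Finset

namespace HilbertSeriesHypersimplex

/-- The coefficients of `(1 + t + t² + ⋯)^n` count the tuples of given sum. -/
theorem coeff_mk_one_pow (n d : ℕ) :
    PowerSeries.coeff d ((PowerSeries.mk 1 : PowerSeries ℤ) ^ n) =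
      ((piAntidiag (univ : Finset (Fin n)) d).card : ℤ) := by
  have h := PowerSeries.coeff_prod (fun _ : Fin n => (PowerSeries.mk 1 : PowerSeries ℤ)) d univ
  simp only [prod_const, card_univ, Fintype.card_fin, PowerSeries.coeff_mk, Pi.one_apply,
    one_pow, sum_const, nsmul_eq_mul, mul_one] at h
  rw [h]
  congr 1
  refine card_bij' (fun f _ => ⇑f) (fun f _ => Finsupp.equivFunOnFinite.symm f) ?_ ?_ ?_ ?_ <;>
    simp [mem_finsuppAntidiag]

theorem one_sub_pow_mul_mk_one_pow (n : ℕ) :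
    (1 - PowerSeries.X : PowerSeries ℤ) ^ n * PowerSeries.mk 1 ^ n = 1 := by
  rw [← mul_pow, mul_comm, PowerSeries.mk_one_mul_one_sub_eq_one, one_pow]

/-- The series `Σ aᵢ tⁱ`, `aᵢ` being the coefficient of `t²ⁱ` in `f`. -/
noncomputable def evenPart (f : PowerSeries ℤ) : PowerSeries ℤ :=
  PowerSeries.mk fun i => PowerSeries.coeff (2 * i) f

theorem evenPart_one_sub_X_sq_mul (f : PowerSeries ℤ) :
    evenPart ((1 - PowerSeries.X ^ 2) * f) = (1 - PowerSeries.X) * evenPart f := by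
  ext i
  rcases i with _ | i
  · simp [evenPart, sub_mul]
  · rw [sub_mul, sub_mul, one_mul, one_mul, map_sub, PowerSeries.coeff_succ_X_mul]
    simp only [evenPart, PowerSeries.coeff_mk, map_sub, mul_add, mul_one,
      PowerSeries.coeff_X_pow_mul]

theorem evenPart_one_sub_X_sq_pow_mul (n : ℕ) (f : PowerSeries ℤ) :
    evenPart ((1 - PowerSeries.X ^ 2) ^ n * f) = (1 - PowerSeries.X) ^ n * evenPart f := by
  induction n with
  | zero => simp
  | succ n ih => rw [pow_succ', mul_assoc, evenPart_one_sub_X_sq_mul, ih, pow_succ', mul_assoc]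

theorem one_sub_pow_mul_evenPart_mk_one_pow (n : ℕ) :
    (1 - PowerSeries.X) ^ n * evenPart (PowerSeries.mk 1 ^ n) =
      PowerSeries.mk (fun l => (n.choose (2 * l) : ℤ)) := by
  have h : (1 - PowerSeries.X ^ 2 : PowerSeries ℤ) = (1 + PowerSeries.X) * (1 - PowerSeries.X) := by
    ring
  rw [← evenPart_one_sub_X_sq_pow_mul, h, mul_pow, mul_assoc, one_sub_pow_mul_mk_one_pow, mul_one]
  ext l
  have hc : (1 + PowerSeries.X : PowerSeries ℤ) ^ n =
      (((1 + Polynomial.X) ^ n : Polynomial ℤ) : PowerSeries ℤ) := by simp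
  rw [evenPart, PowerSeries.coeff_mk, PowerSeries.coeff_mk, hc, Polynomial.coeff_coe,
    Polynomial.coeff_one_add_X_pow]

/-- Lowering the `j`-th entry by `c` identifies the tuples of sum `c + d` whose `j`-th entry
is at least `c` with the tuples of sum `d`. -/
theorem card_filter_le_apply_piAntidiag {n : ℕ} (j : Fin n) (c d : ℕ) :
    ((piAntidiag (univ : Finset (Fin n)) (c + d)).filter fun α => c ≤ α j).card =
      (piAntidiag (univ : Finset (Fin n)) d).card := by
  have hs : ∑ k, (Pi.single j c : Fin n → ℕ) k = c := by simp
  have hle {α : Fin n → ℕ} (h : c ≤ α j) : Pi.single j c ≤ α := by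
    intro k
    rcases eq_or_ne k j with rfl | hk
    · simpa using h
    · simp [hk]
  refine card_bij' (fun α _ => α - Pi.single j c) (fun β _ => β + Pi.single j c) ?_ ?_ ?_ ?_
  · intro α hα
    simp only [mem_filter, mem_piAntidiag, mem_univ, implies_true, and_true] at hα ⊢
    have h : ∑ k, (α - Pi.single j c + Pi.single j c : Fin n → ℕ) k = c + d := by
      rw [tsub_add_cancel_of_le (hle hα.2), hα.1]
    simp only [Pi.add_apply, sum_add_distrib, hs] at h
    exact Nat.add_right_cancel (h.trans (add_comm c d))
  · intro β hβ
    simp only [mem_filter, mem_piAntidiag, mem_univ, implies_true, and_true] at hβ ⊢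
    simp only [Pi.add_apply, sum_add_distrib, hs, hβ, Pi.single_eq_same]
    omega
  · intro α hα
    exact tsub_add_cancel_of_le (hle (mem_filter.1 hα).2)
  · intro β _
    exact add_tsub_cancel_right _ _

theorem card_filter_lt_apply_piAntidiag {n : ℕ} (j : Fin n) (i : ℕ) :
    (((piAntidiag (univ : Finset (Fin n)) (2 * i)).filter fun α => i < α j).card : ℤ) =
      PowerSeries.coeff i (PowerSeries.X * PowerSeries.mk 1 ^ n : PowerSeries ℤ) := by
  rcases i with _ | i
  · simp +contextual [filter_eq_empty_iff]
  · rw [PowerSeries.coeff_succ_X_mul, coeff_mk_one_pow,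
      ← card_filter_le_apply_piAntidiag j (i + 2) i]
    congr 4
    omega

theorem card_filter_sum_eq_add (n i : ℕ) :
    ((Fintype.piFinset fun _ : Fin n => range (i + 1)).filter fun α => ∑ j, α j = 2 * i).card +
        ∑ j : Fin n, ((piAntidiag (univ : Finset (Fin n)) (2 * i)).filter fun α => i < α j).card =
      (piAntidiag (univ : Finset (Fin n)) (2 * i)).card := by
  classical
  have hd : ((univ : Finset (Fin n)) : Set (Fin n)).PairwiseDisjoint fun j =>
      (piAntidiag (univ : Finset (Fin n)) (2 * i)).filter fun α => i < α j := by
    intro j _ k _ hjk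
    refine disjoint_left.2 fun α hj hk => ?_
    simp only [mem_filter, mem_piAntidiag, mem_univ, implies_true, and_true] at hj hk
    have h := sum_le_sum_of_subset (f := α) (subset_univ {j, k})
    rw [sum_pair hjk, hj.1] at h
    omega
  rw [← card_biUnion hd, ← card_filter_add_card_filter_not
    (s := piAntidiag (univ : Finset (Fin n)) (2 * i)) (fun α => ∀ j, α j ≤ i)]
  congr 2 <;> ext α <;> simp [and_comm]

theorem mk_card_eq (n : ℕ) :
    PowerSeries.mk (fun i =>
        ((Finset.filter (fun α : Fin n → ℕ => ∑ j, α j = 2 * i)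
          (Fintype.piFinset fun _ => Finset.range (i + 1))).card : ℤ)) =
      evenPart (PowerSeries.mk 1 ^ n) -
        (n : PowerSeries ℤ) * (PowerSeries.X * PowerSeries.mk 1 ^ n) := by
  ext i
  have h := congrArg (Nat.cast : ℕ → ℤ) (card_filter_sum_eq_add n i)
  push_cast at h
  simp only [card_filter_lt_apply_piAntidiag, sum_const, card_univ, Fintype.card_fin] at h
  rw [← nsmul_eq_mul, map_sub, map_nsmul, evenPart, PowerSeries.coeff_mk, PowerSeries.coeff_mk,
    coeff_mk_one_pow, ← h, add_sub_cancel_right]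

end HilbertSeriesHypersimplex



/-- The Hilbert series of the second hypersimplex algebra `𝒱(1,…,1; 2)`: with `H(i)`
the number of tuples `(α₁,…,αₙ)` of non-negative integers with `Σ αⱼ = 2i` and
`αⱼ ≤ i`, in `ℤ⟦t⟧` one has
`(1−t)^n Σ_i H(i) t^i = (Σ_{l≥0} C(n, 2l) t^l) − n·t`. -/
theorem hilbert_series_second_hypersimplex (n : ℕ) (hn : 3 ≤ n) :
    (1 - PowerSeries.X : PowerSeries ℤ) ^ n *
        PowerSeries.mk (fun i =>
          ((Finset.filter (fun α : Fin n → ℕ => ∑ j, α j = 2 * i)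
              (Fintype.piFinset fun _ => Finset.range (i + 1))).card : ℤ)) =
      PowerSeries.mk (fun l => (n.choose (2 * l) : ℤ)) -
        (n : PowerSeries ℤ) * PowerSeries.X := by
  rw [HilbertSeriesHypersimplex.mk_card_eq, mul_sub,
    HilbertSeriesHypersimplex.one_sub_pow_mul_evenPart_mk_one_pow]
  congr 1
  linear_combination (n : PowerSeries ℤ) * PowerSeries.X *
    HilbertSeriesHypersimplex.one_sub_pow_mul_mk_one_pow n
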